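/- arXiv:1510.08149 — 7 statements merged into one kernel-verified Lean document; each statement's English description precedes it below -/
import Mathlib

section
/- Let p ≥ 2, let a be a p-automatic sequence, and let r be an integer with 0 ≤ r < p. Then there exist u ∈ N(a) and an integer m ≥ 1 such that u_n = u_{p^m n + j} for all n ≥ 1, where j = r·(p^m − 1)/(p − 1) (the integer whose base-p expansion consists of the digit r repeated m times). In particular, u possesses a relation of type r. -/
open scoped Classical

/-- `a k` encodes the term of index `k + 1` of a sequence `(a_n)_{n ≥ 1}` indexed from `1`.
`subSeq p a i j` encodes the subsequence `a^{(i,j)}` defined by `a^{(i,j)}_n = a_{p^i n + j}`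
for `n ≥ 1`. -/
def subSeq (p : ℕ) {Δ : Type*} (a : ℕ → Δ) (i j : ℕ) : ℕ → Δ :=
  fun k => a (p ^ i * (k + 1) + j - 1)

/-- `N(a)`: the set of all subsequences `a^{(i,j)}` with `0 ≤ j < p^i`. -/
def NSet (p : ℕ) {Δ : Type*} (a : ℕ → Δ) : Set (ℕ → Δ) :=
  {u | ∃ i j : ℕ, j < p ^ i ∧ u = subSeq p a i j}

/-- `a` is `p`-automatic iff `N(a)` is finite. -/
def IsAutomatic (p : ℕ) {Δ : Type*} (a : ℕ → Δ) : Prop :=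
  (NSet p a).Finite

/-- For every `r < p` there is `u ∈ N(a)` possessing a relation of type `r`: for some `m ≥ 1`,
`u_n = u_{p^m n + j}` for all `n ≥ 1`, where `j = r · (p^m - 1)/(p - 1)` is the integer whose
base-`p` expansion is the digit `r` repeated `m` times. -/
theorem stmt_2 {p : ℕ} (hp : 2 ≤ p) {Δ : Type*} [Finite Δ] (a : ℕ → Δ)
    (ha : IsAutomatic p a) (r : ℕ) (hr : r < p) :
    ∃ u ∈ NSet p a, ∃ m : ℕ, 1 ≤ m ∧
      subSeq p u m (r * (p ^ m - 1) / (p - 1)) = u := by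
  have hS : ∀ m, (p - 1) * (∑ i ∈ Finset.range m, p ^ i) = p ^ m - 1 := by
    intro m
    have h := Nat.geomSum_eq hp m
    have hd : (p - 1) ∣ p ^ m - 1 := by simpa using Nat.sub_dvd_pow_sub_pow p 1 m
    rw [h, Nat.mul_div_cancel' hd]
  have hR : ∀ m, r * (p ^ m - 1) / (p - 1) = r * ∑ i ∈ Finset.range m, p ^ i := by
    intro m
    rw [← hS m, Nat.mul_left_comm, Nat.mul_div_cancel_left _ (by omega)]
  have hlt : ∀ m, r * ∑ i ∈ Finset.range m, p ^ i < p ^ m := by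
    intro m
    have h1 : r * ∑ i ∈ Finset.range m, p ^ i ≤ (p - 1) * ∑ i ∈ Finset.range m, p ^ i :=
      Nat.mul_le_mul_right _ (by omega)
    have h2 := hS m
    have h3 : 0 < p ^ m := Nat.pow_pos (by omega)
    omega
  let f : ℕ → ℕ → Δ := fun s => subSeq p a s (r * ∑ i ∈ Finset.range s, p ^ i)
  have hf : ∀ s, f s ∈ NSet p a := fun s => ⟨s, _, hlt s, rfl⟩
  have key : ∀ s t, s < t → f s = f t → ∃ u ∈ NSet p a, ∃ m : ℕ, 1 ≤ m ∧
      subSeq p u m (r * (p ^ m - 1) / (p - 1)) = u := by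
    intro s t hst he
    obtain ⟨m, rfl⟩ := Nat.exists_eq_add_of_lt hst
    refine ⟨f s, hf s, m + 1, by omega, ?_⟩
    rw [hR, he.trans rfl]
    conv_lhs => rw [← he]
    funext k
    simp only [f, subSeq]
    have h3 : 0 < p ^ (m + 1) * (k + 1) := Nat.mul_pos (Nat.pow_pos (by omega)) (by omega)
    rw [Nat.sub_add_cancel (by omega), add_assoc s m 1, Finset.sum_range_add _ s (m + 1)]
    congr 2
    simp only [pow_add p s, ← Finset.mul_sum]
    ring
  obtain ⟨s, -, t, -, hne, he⟩ :=
    Set.infinite_univ.exists_ne_map_eq_of_mapsTo (f := f) (fun s _ => hf s) ha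
  rcases lt_or_gt_of_ne hne with h | h
  · exact key s t h he
  · exact key t s h he.symm
end

section
/- Let p ≥ 2 and let a be a p-automatic sequence which is homogeneous. Then a has global relations of all types: for every integer r with 0 ≤ r < p, there exists a pair (i,j) with 0 ≤ j < p^i, (i,j) ≠ (0,0), of type r, such that u^{(i,j)} = u for every u ∈ N(a). -/
open scoped Classical

/-- `rel(a)`: the set of relations of `a`: pairs `(i,j)` with `j < p^i`, `(i,j) ≠ (0,0)`
and `a^{(i,j)} = a`. -/
def relSet (p : ℕ) {Δ : Type*} (a : ℕ → Δ) : Set (ℕ × ℕ) :=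
  {ij | ij.2 < p ^ ij.1 ∧ ij ≠ (0, 0) ∧ subSeq p a ij.1 ij.2 = a}

/-- `a` is homogeneous if every `u ∈ N(a)` satisfies `N(u) = N(a)` and `rel(u) = rel(a)`. -/
def Homogeneous (p : ℕ) {Δ : Type*} (a : ℕ → Δ) : Prop :=
  ∀ u ∈ NSet p a, NSet p u = NSet p a ∧ relSet p u = relSet p a

theorem aux_iter {p : ℕ} (hp : 2 ≤ p) {Δ : Type*} (r : ℕ) (hr : r < p) (u : ℕ → Δ) (k : ℕ) :
    ∃ j, j < p ^ k ∧ (fun v : ℕ → Δ => subSeq p v 1 r)^[k] u = subSeq p u k j ∧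
      (1 ≤ k → j / p ^ (k - 1) = r) := by
  induction k with
  | zero =>
    refine ⟨0, by simp, ?_, by omega⟩
    funext n
    simp [subSeq]
  | succ k ih =>
    obtain ⟨j, hj, he, -⟩ := ih
    have hpk : 0 < p ^ k := by positivity
    refine ⟨p ^ k * r + j, ?_, ?_, ?_⟩
    · have : p ^ k * (r + 1) ≤ p ^ k * p := Nat.mul_le_mul_left _ hr
      rw [pow_succ]
      linarith
    · rw [Function.iterate_succ_apply', he]
      funext n
      simp only [subSeq]
      congr 1
      have h1 : 1 ≤ p ^ 1 * (n + 1) + r := by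
        have : 0 < p ^ 1 * (n + 1) := by positivity
        omega
      rw [Nat.sub_add_cancel h1]
      congr 1
      ring
    · intro _
      rw [Nat.add_sub_cancel, Nat.mul_add_div hpk, Nat.div_eq_of_lt hj, add_zero]

/-- A homogeneous `p`-automatic sequence has global relations of all types: for every `r < p`
there is a pair `(i,j)`, `j < p^i`, `(i,j) ≠ (0,0)`, whose type `j / p^(i-1)` is `r`, and which
is a relation for every `u ∈ N(a)`. -/
theorem stmt_3 {p : ℕ} (hp : 2 ≤ p) {Δ : Type*} [Finite Δ] (a : ℕ → Δ)
    (ha : IsAutomatic p a) (hhom : Homogeneous p a) (r : ℕ) (hr : r < p) :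
    ∃ i j : ℕ, j < p ^ i ∧ (i, j) ≠ (0, 0) ∧ j / p ^ (i - 1) = r ∧
      ∀ u ∈ NSet p a, subSeq p u i j = u := by
  have hmem : ∀ m, (fun v : ℕ → Δ => subSeq p v 1 r)^[m] a ∈ NSet p a := by
    intro m
    obtain ⟨j, hj, he, -⟩ := aux_iter hp r hr a m
    exact ⟨m, j, hj, he⟩
  have hex : ∃ m n, m < n ∧ (fun v : ℕ → Δ => subSeq p v 1 r)^[m] a =
      (fun v : ℕ → Δ => subSeq p v 1 r)^[n] a := by
    by_contra hcon
    push Not at hcon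
    refine Set.infinite_of_injective_forall_mem
      (f := fun m => (fun v : ℕ → Δ => subSeq p v 1 r)^[m] a) ?_ hmem ha
    intro m n hmn
    rcases lt_trichotomy m n with h | h | h
    · exact absurd hmn (hcon _ _ h)
    · exact h
    · exact absurd hmn.symm (hcon _ _ h)
  obtain ⟨m, n, hmn, he⟩ := hex
  obtain ⟨k, rfl⟩ : ∃ k, n = k + m := ⟨n - m, by omega⟩
  rw [Function.iterate_add_apply] at he
  obtain ⟨j, hj, hj2, hj3⟩ := aux_iter hp r hr ((fun v : ℕ → Δ => subSeq p v 1 r)^[m] a) k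
  have hne : (k, j) ≠ (0, 0) := by
    intro h
    have := congrArg Prod.fst h
    simp only at this
    omega
  refine ⟨k, j, hj, hne, hj3 (by omega), ?_⟩
  intro u hu
  have h1 : (k, j) ∈ relSet p ((fun v : ℕ → Δ => subSeq p v 1 r)^[m] a) :=
    ⟨hj, hne, (he.trans hj2).symm⟩
  rw [(hhom _ (hmem m)).2, ← (hhom u hu).2] at h1
  exact h1.2.2
end

section
/- Let a be a 2-automatic sequence. Then a has global relations of all types if and only if the maps t_0 and t_1 are bijections of N(a) (equivalently, the monoid G(a) is a group). -/
open scoped Classical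

theorem subSeq_subSeq {Δ : Type*} (a : ℕ → Δ) (i j i' j' : ℕ) :
    subSeq 2 (subSeq 2 a i j) i' j' = subSeq 2 a (i + i') (2 ^ i * j' + j) := by
  funext k
  unfold subSeq
  have h1 : 0 < 2 ^ i' * (k + 1) := by positivity
  have h2 : 2 ^ i' * (k + 1) + j' - 1 + 1 = 2 ^ i' * (k + 1) + j' := by omega
  rw [h2]
  congr 2
  ring

theorem mem_NSet_subSeq {Δ : Type*} {a u : ℕ → Δ} (hu : u ∈ NSet 2 a) {i j : ℕ}
    (hj : j < 2 ^ i) : subSeq 2 u i j ∈ NSet 2 a := by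
  obtain ⟨i0, j0, h0, rfl⟩ := hu
  refine ⟨i0 + i, 2 ^ i0 * j + j0, ?_, subSeq_subSeq a i0 j0 i j⟩
  rw [pow_add]
  nlinarith [Nat.mul_le_mul_left (2 ^ i0) (Nat.succ_le_of_lt hj)]

theorem iter_subSeq {Δ : Type*} (u : ℕ → Δ) (r m : ℕ) :
    (fun u : ℕ → Δ => subSeq 2 u 1 r)^[m] u = subSeq 2 u m (r * (2 ^ m - 1)) := by
  induction m with
  | zero => funext k; simp [subSeq]
  | succ m ih =>
    rw [Function.iterate_succ_apply', ih]
    show subSeq 2 (subSeq 2 u m _) 1 r = _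
    rw [subSeq_subSeq]
    congr 1
    obtain ⟨q, hq⟩ : ∃ q, 2 ^ m = q + 1 := Nat.exists_eq_succ_of_ne_zero (by positivity)
    rw [pow_succ, hq]
    have : (q + 1) * 2 - 1 = q + (q + 1) := by omega
    rw [this, Nat.add_sub_cancel]
    ring

theorem exists_iter_eq {α : Type*} {s : Set α} (hs : s.Finite) {f : α → α}
    (hf : Set.BijOn f s s) : ∃ m, 0 < m ∧ ∀ u ∈ s, f^[m] u = u := by
  have : Finite s := hs
  let e : Equiv.Perm s := hf.equiv f
  refine ⟨orderOf e, orderOf_pos e, fun u hu => ?_⟩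
  have key : ∀ n, ∀ v : s, ((e ^ n) v : α) = f^[n] v := by
    intro n
    induction n with
    | zero => intro v; simp
    | succ n ih =>
      intro v
      rw [pow_succ', Function.iterate_succ_apply', ← ih]
      rfl
  have := key (orderOf e) ⟨u, hu⟩
  rw [pow_orderOf_eq_one] at this
  exact this.symm

/-- A `2`-automatic sequence has global relations of all types (a global relation of type `r`
being a pair `(i,j)`, `j < 2^i`, `(i,j) ≠ (0,0)`, with `j / 2^(i-1) = r`, which is a relation
for every `u ∈ N(a)`) iff the maps `t_0, t_1 : u ↦ u^{(1,i)}` are bijections of `N(a)`. -/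
theorem stmt_4 {Δ : Type*} [Finite Δ] (a : ℕ → Δ) (ha : IsAutomatic 2 a) :
    (∀ r < 2, ∃ i j : ℕ, j < 2 ^ i ∧ (i, j) ≠ (0, 0) ∧ j / 2 ^ (i - 1) = r ∧
        ∀ u ∈ NSet 2 a, subSeq 2 u i j = u)
      ↔ ∀ i < 2, Set.BijOn (fun u => subSeq 2 u 1 i) (NSet 2 a) (NSet 2 a) := by
  constructor
  · intro H r hr
    obtain ⟨i, j, hj, hne, hjr, hrel⟩ := H r hr
    have hmaps : Set.MapsTo (fun u => subSeq 2 u 1 r) (NSet 2 a) (NSet 2 a) :=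
      fun u hu => mem_NSet_subSeq hu (by simpa using hr)
    have hsurj : Set.SurjOn (fun u => subSeq 2 u 1 r) (NSet 2 a) (NSet 2 a) := by
      intro u hu
      cases i with
      | zero => exfalso; apply hne; simp at hj; simp [hj]
      | succ i =>
        refine ⟨subSeq 2 u i (j % 2 ^ i), mem_NSet_subSeq hu (Nat.mod_lt _ (by positivity)), ?_⟩
        show subSeq 2 (subSeq 2 u i (j % 2 ^ i)) 1 r = u
        rw [subSeq_subSeq]
        simp only [Nat.add_sub_cancel] at hjr
        rw [← hjr, Nat.div_add_mod]
        exact hrel u hu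
    have ha' : (NSet 2 a).Finite := ha
    exact ⟨hmaps, (ha'.surjOn_iff_bijOn_of_mapsTo hmaps).1 hsurj |>.injOn, hsurj⟩
  · intro H r hr
    obtain ⟨m, hm, hu⟩ := exists_iter_eq ha (H r hr)
    have hp : 0 < 2 ^ m := by positivity
    refine ⟨m, r * (2 ^ m - 1), ?_, ?_, ?_, fun u h => ?_⟩
    · interval_cases r <;> omega
    · intro h
      simp at h
      omega
    · obtain ⟨k, rfl⟩ : ∃ k, m = k + 1 := ⟨m - 1, by omega⟩
      have hk : 0 < 2 ^ k := by positivity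
      interval_cases r
      · simp
      · rw [Nat.add_sub_cancel, one_mul, pow_succ]
        apply Nat.div_eq_of_lt_le <;> omega
    · rw [← iter_subSeq]
      exact hu u h
end

section
/- Let a be a 2-automatic sequence, and suppose a is produced by an automaton whose underlying graph is the Schreier graph of a finite group G, generated by distinguished elements t_0, t_1, acting faithfully and transitively on the right on a finite set Q, with initial state q₀ ∈ Q and labeling map τ : Q → Δ (so that a_n = τ(q₀ · t_{d_0} t_{d_1} ⋯ t_{d_k}), where d_k ⋯ d_0 are the base-2 digits of n, d_0 least significant). Then |Q| ≥ |N(a)|, with equality if and only if the following condition (†) holds: for every h ∈ G, if τ(q₀ · (h g)) = τ(q₀ · g) for all g ∈ G, then q₀ · h = q₀. -/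
open scoped Classical

/-- The sequence produced by the automaton whose underlying graph is the Schreier graph of the
right action `act` of a group with distinguished generators `t 0, …, t (p-1)` on `Q`, with
initial state `q₀` and labeling map `τ`: the base-`p` digits of `n = k + 1` are read from right
to left (least significant digit first). -/
def schreierSeq (p : ℕ) {Q G Δ : Type*} (act : Q → G → Q) (t : ℕ → G) (q₀ : Q)
    (τ : Q → Δ) : ℕ → Δ :=
  fun k => τ ((Nat.digits p (k + 1)).foldl (fun q d => act q (t d)) q₀)

theorem fold_eq_aux {Q G : Type*} [Group G] (t : ℕ → G)
    (act : Q → G → Q) (hact_one : ∀ q, act q 1 = q)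
    (hact_mul : ∀ (q : Q) (g h : G), act q (g * h) = act (act q g) h) (w : List ℕ) (q : Q) :
    w.foldl (fun q d => act q (t d)) q = act q (w.map t).prod := by
  induction w generalizing q with
  | nil => simp [hact_one]
  | cons d w ih => simp [ih, hact_mul]

theorem digits_aux (w : List ℕ) (hw : ∀ d ∈ w, d < 2) (n : ℕ) (hn : n ≠ 0) :
    Nat.digits 2 (2 ^ w.length * n + Nat.ofDigits 2 w) = w ++ Nat.digits 2 n := by
  have h : 2 ^ w.length * n + Nat.ofDigits 2 w = Nat.ofDigits 2 (w ++ Nat.digits 2 n) := by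
    rw [Nat.ofDigits_append, Nat.ofDigits_digits, add_comm]
  rw [h]
  have hne : Nat.digits 2 n ≠ [] := Nat.digits_ne_nil_iff_ne_zero.2 hn
  apply Nat.digits_ofDigits 2 (by norm_num)
  · intro l hl
    rcases List.mem_append.1 hl with hl | hl
    · exact hw l hl
    · exact Nat.digits_lt_base (by norm_num) hl
  · intro h
    rw [List.getLast_append_of_ne_nil _ hne]
    exact Nat.getLast_digit_ne_zero 2 hn

theorem word_aux (i : ℕ) : ∀ j < 2 ^ i, ∃ w : List ℕ, (∀ d ∈ w, d < 2) ∧ w.length = i ∧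
    Nat.ofDigits 2 w = j := by
  induction i with
  | zero => intro j hj; exact ⟨[], by simp, rfl, by simp at hj; simp [hj]⟩
  | succ i ih =>
    intro j hj
    obtain ⟨w, h1, h2, h3⟩ := ih (j / 2) (by rw [pow_succ] at hj; omega)
    refine ⟨(j % 2) :: w, ?_, by simp [h2], ?_⟩
    · intro d hd
      rcases List.mem_cons.1 hd with rfl | hd
      · omega
      · exact h1 d hd
    · rw [Nat.ofDigits_cons, h3]; omega

theorem gen_aux {G : Type*} [Group G] [Finite G] (t : ℕ → G)
    (hgen : Subgroup.closure {t 0, t 1} = ⊤) (g : G) :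
    ∃ w : List ℕ, (∀ d ∈ w, d < 2) ∧ (w.map t).prod = g := by
  have hg : g ∈ Submonoid.closure {t 0, t 1} := by
    rw [← Subgroup.closure_toSubmonoid_of_finite, hgen]; trivial
  induction hg using Submonoid.closure_induction with
  | mem x hx =>
    rcases hx with rfl | rfl
    · exact ⟨[0], by simp, by simp⟩
    · exact ⟨[1], by simp, by simp⟩
  | one => exact ⟨[], by simp, by simp⟩
  | mul x y _ _ hx hy =>
    obtain ⟨u, hu, rfl⟩ := hx
    obtain ⟨v, hv, rfl⟩ := hy
    refine ⟨u ++ v, ?_, by simp⟩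
    intro d hd
    rcases List.mem_append.1 hd with h | h
    · exact hu d h
    · exact hv d h

/-- If the `2`-automatic sequence `a` is produced by an automaton on the Schreier graph of a
faithful transitive right action of a finite group `G` (generated by `t 0, t 1`) on `Q`, then
`|Q| ≥ |N(a)|`, with equality iff condition `(†)` holds. -/
theorem stmt_6 {G Q Δ : Type*} [Group G] [Finite G] [Finite Q] [Finite Δ]
    (t : ℕ → G) (hgen : Subgroup.closure {t 0, t 1} = ⊤)
    (act : Q → G → Q) (hact_one : ∀ q, act q 1 = q)
    (hact_mul : ∀ (q : Q) (g h : G), act q (g * h) = act (act q g) h)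
    (hfaithful : ∀ g : G, (∀ q : Q, act q g = q) → g = 1)
    (htrans : ∀ q q' : Q, ∃ g : G, act q g = q')
    (q₀ : Q) (τ : Q → Δ) (a : ℕ → Δ) (haeq : a = schreierSeq 2 act t q₀ τ) :
    (NSet 2 a).ncard ≤ Nat.card Q ∧
      (Nat.card Q = (NSet 2 a).ncard ↔
        ∀ h : G, (∀ g : G, τ (act q₀ (h * g)) = τ (act q₀ g)) → act q₀ h = q₀) := by
  subst haeq
  have hfold := fold_eq_aux t act hact_one hact_mul
  have hsub : ∀ (w : List ℕ), (∀ d ∈ w, d < 2) →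
      subSeq 2 (schreierSeq 2 act t q₀ τ) w.length (Nat.ofDigits 2 w)
        = schreierSeq 2 act t (act q₀ (w.map t).prod) τ := by
    intro w hw
    funext k
    have hpos : 0 < 2 ^ w.length * (k + 1) := by positivity
    unfold subSeq schreierSeq
    rw [Nat.sub_add_cancel (by omega), digits_aux w hw _ (by omega), List.foldl_append, hfold w]
  have hN : NSet 2 (schreierSeq 2 act t q₀ τ) =
      Set.range (fun q => schreierSeq 2 act t q τ) := by
    ext u
    constructor
    · rintro ⟨i, j, hj, rfl⟩
      obtain ⟨w, hw, rfl, rfl⟩ := word_aux i j hj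
      exact ⟨_, (hsub w hw).symm⟩
    · rintro ⟨q, rfl⟩
      obtain ⟨g, rfl⟩ := htrans q₀ q
      obtain ⟨w, hw, rfl⟩ := gen_aux t hgen g
      exact ⟨w.length, Nat.ofDigits 2 w, Nat.ofDigits_lt_base_pow_length (by norm_num) hw,
        (hsub w hw).symm⟩
  have hF : ∀ q q', schreierSeq 2 act t q τ = schreierSeq 2 act t q' τ ↔
      ∀ g, τ (act q g) = τ (act q' g) := by
    intro q q'
    constructor
    · intro h g
      obtain ⟨w, hw, hg⟩ := gen_aux t hgen (g * (t 1)⁻¹)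
      have hd := digits_aux w hw 1 one_ne_zero
      have h2 : 0 < 2 ^ w.length := by positivity
      have := congrFun h (2 ^ w.length * 1 + Nat.ofDigits 2 w - 1)
      unfold schreierSeq at this
      rw [Nat.sub_add_cancel (by omega), hd, hfold, hfold] at this
      simpa [hg] using this
    · intro h
      funext k
      unfold schreierSeq
      rw [hfold, hfold, h]
  have hinj : Function.Injective (fun q => schreierSeq 2 act t q τ) ↔
      ∀ h : G, (∀ g : G, τ (act q₀ (h * g)) = τ (act q₀ g)) → act q₀ h = q₀ := by
    constructor
    · intro hi h hh
      apply hi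
      apply (hF _ _).2
      intro g
      rw [← hact_mul, hh]
    · intro hd q q' hqq
      have hqq := (hF _ _).1 hqq
      obtain ⟨x, rfl⟩ := htrans q₀ q
      obtain ⟨y, rfl⟩ := htrans q₀ q'
      have := hd (x * y⁻¹) (by
        intro g
        have := hqq (y⁻¹ * g)
        rw [← hact_mul, ← hact_mul] at this
        simpa [mul_assoc] using this)
      calc act q₀ x = act (act q₀ (x * y⁻¹)) y := by rw [← hact_mul]; simp
        _ = _ := by rw [this]
  rw [hN, ← hinj, ← Set.image_univ, ← Set.ncard_univ Q]
  refine ⟨Set.ncard_image_le Set.finite_univ, ?_⟩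
  rw [eq_comm, Set.ncard_image_iff Set.finite_univ, Set.injOn_univ]
end

section
/- Let p ≥ 2, let G be a finite group generated by distinguished elements t_0, …, t_{p−1}, acting faithfully and transitively on the right on a finite set Q, let q₀ ∈ Q and let τ : Q → Δ satisfy condition (†): for every h ∈ G, if τ(q₀ · (h g)) = τ(q₀ · g) for all g ∈ G, then q₀ · h = q₀. Let a be the sequence produced by the associated Schreier-graph automaton: a_n = τ(q₀ · t_{d_0} t_{d_1} ⋯ t_{d_k}), where d_k ⋯ d_0 are the base-p digits of n (d_0 least significant). Then: (1) a has global relations of all types; (2) each map t_i : N(a) → N(a) is a bijection; (3) there is a bijection β : Q → N(a) with β(q₀) = a and β(q · t_i) = t_i(β(q)) for all q ∈ Q and 0 ≤ i < p; consequently, the map sending g ∈ G to the permutation β ∘ (· g) ∘ β^{−1} of N(a) is a group isomorphism from G onto the group G(a), carrying each generator t_i of G to the map t_i on N(a). -/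
open scoped Classical

theorem sub_foldl {p : ℕ} (hp : 2 ≤ p) {Δ : Type*} (w : List ℕ) : ∀ (u : ℕ → Δ),
    w.foldl (fun v d => subSeq p v 1 d) u = subSeq p u w.length (Nat.ofDigits p w) := by
  induction w with
  | nil => intro u; funext k; simp [subSeq]
  | cons d w ih =>
    intro u
    rw [List.foldl_cons, ih]
    funext k
    simp only [subSeq, List.length_cons, Nat.ofDigits_cons]
    congr 1
    have h1 : 0 < p ^ w.length * (k + 1) := by positivity
    have h2 : p ^ w.length * (k + 1) + Nat.ofDigits p w - 1 + 1
        = p ^ w.length * (k + 1) + Nat.ofDigits p w := by omega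
    rw [h2]
    congr 1
    ring_nf
    try simp

theorem word_of {p : ℕ} (hp : 2 ≤ p) (i : ℕ) : ∀ j, j < p ^ i →
    ∃ w : List ℕ, w.length = i ∧ (∀ d ∈ w, d < p) ∧ Nat.ofDigits p w = j := by
  induction i with
  | zero => intro j hj; exact ⟨[], rfl, by simp, by simp at hj; simp [hj]⟩
  | succ i ih =>
    intro j hj
    have hj' : j / p < p ^ i := by
      apply Nat.div_lt_of_lt_mul
      rwa [pow_succ, mul_comm] at hj
    obtain ⟨w, h1, h2, h3⟩ := ih _ hj'
    refine ⟨(j % p) :: w, by simp [h1], ?_, ?_⟩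
    · intro d hd
      rcases List.mem_cons.1 hd with rfl | hd
      · exact Nat.mod_lt _ (by omega)
      · exact h2 d hd
    · rw [Nat.ofDigits_cons, h3]
      simpa using Nat.mod_add_div j p

theorem exists_word {p : ℕ} {G : Type*} [Group G] [Finite G]
    (t : ℕ → G) (hgen : Subgroup.closure (t '' Set.Iio p) = ⊤) (g : G) :
    ∃ w : List ℕ, (∀ d ∈ w, d < p) ∧ (w.map t).prod = g := by
  have hg : g ∈ Subgroup.closure (t '' Set.Iio p) := by rw [hgen]; trivial
  induction hg using Subgroup.closure_induction with
  | mem x hx =>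
    obtain ⟨d, hd, rfl⟩ := hx
    exact ⟨[d], by simpa using hd, by simp⟩
  | one => exact ⟨[], by simp, by simp⟩
  | mul x y _ _ hx hy =>
    obtain ⟨w, h1, rfl⟩ := hx
    obtain ⟨v, h2, rfl⟩ := hy
    refine ⟨w ++ v, ?_, by simp⟩
    intro d hd
    rcases List.mem_append.1 hd with hd | hd
    · exact h1 d hd
    · exact h2 d hd
  | inv x _ hx =>
    obtain ⟨w, h1, rfl⟩ := hx
    have key : ∀ n : ℕ, ∃ v : List ℕ, (∀ d ∈ v, d < p) ∧ (v.map t).prod = (w.map t).prod ^ n := by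
      intro n
      induction n with
      | zero => exact ⟨[], by simp, by simp⟩
      | succ n ih =>
        obtain ⟨v, h2, h3⟩ := ih
        refine ⟨v ++ w, ?_, by simp [h3, pow_succ]⟩
        intro d hd
        rcases List.mem_append.1 hd with hd | hd
        · exact h2 d hd
        · exact h1 d hd
    obtain ⟨v, h2, h3⟩ := key (Nat.card G - 1)
    refine ⟨v, h2, ?_⟩
    rw [h3]
    apply eq_inv_of_mul_eq_one_left
    rw [← pow_succ, Nat.sub_add_cancel Nat.card_pos, pow_card_eq_one']

theorem exists_word_last {p : ℕ} {G : Type*} [Group G] [Finite G]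
    (t : ℕ → G) (hgen : Subgroup.closure (t '' Set.Iio p) = ⊤) (g : G) (r : ℕ) :
    ∃ w : List ℕ, (∀ d ∈ w, d < p) ∧ ((w ++ [r]).map t).prod = g := by
  obtain ⟨w, h, h2⟩ := exists_word t hgen (g * (t r)⁻¹)
  exact ⟨w, h, by simp [h2]⟩

/-- If `a` is produced by the Schreier-graph automaton of a faithful transitive right action of
a finite group `G` (with distinguished generators `t 0, …, t (p-1)`) on `Q`, satisfying the
minimality condition `(†)`, then: (1) `a` has global relations of all types; (2) each map
`t_i : u ↦ u^{(1,i)}` is a bijection of `N(a)`; (3) there is a bijection `β : Q → N(a)`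
intertwining the action with the `t_i`, and `g ↦ β ∘ (· g) ∘ β⁻¹` is a group isomorphism from
`G` onto `G(a)` (with the composition convention `u^{g h} = (u^g)^h`) carrying each generator
`t i` of `G` to the map `t_i` on `N(a)`; here `G(a)` is described as the set of all composites
of the maps `t_i`, i.e. of words in `t_0, …, t_{p-1}`. -/
theorem stmt_7 {p : ℕ} (hp : 2 ≤ p) {G Q Δ : Type*} [Group G] [Finite G] [Finite Q] [Finite Δ]
    (t : ℕ → G) (hgen : Subgroup.closure (t '' Set.Iio p) = ⊤)
    (act : Q → G → Q) (hact_one : ∀ q, act q 1 = q)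
    (hact_mul : ∀ (q : Q) (g h : G), act q (g * h) = act (act q g) h)
    (hfaithful : ∀ g : G, (∀ q : Q, act q g = q) → g = 1)
    (htrans : ∀ q q' : Q, ∃ g : G, act q g = q')
    (q₀ : Q) (τ : Q → Δ)
    (hdagger : ∀ h : G, (∀ g : G, τ (act q₀ (h * g)) = τ (act q₀ g)) → act q₀ h = q₀)
    (a : ℕ → Δ) (haeq : a = schreierSeq p act t q₀ τ) :
    (∀ r < p, ∃ i j : ℕ, j < p ^ i ∧ (i, j) ≠ (0, 0) ∧ j / p ^ (i - 1) = r ∧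
        ∀ u ∈ NSet p a, subSeq p u i j = u) ∧
    (∀ i < p, Set.BijOn (fun u => subSeq p u 1 i) (NSet p a) (NSet p a)) ∧
    ∃ β : Q → (ℕ → Δ),
      β q₀ = a ∧ Set.range β = NSet p a ∧ Function.Injective β ∧
      (∀ q : Q, ∀ i < p, β (act q (t i)) = subSeq p (β q) 1 i) ∧
      ∃ Φ : G → ((ℕ → Δ) → (ℕ → Δ)),
        (∀ (g : G) (q : Q), Φ g (β q) = β (act q g)) ∧
        (∀ g₁ g₂ : G, (∀ u ∈ NSet p a, Φ g₁ u = Φ g₂ u) → g₁ = g₂) ∧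
        (∀ g h : G, ∀ u ∈ NSet p a, Φ (g * h) u = Φ h (Φ g u)) ∧
        (∀ i < p, ∀ u ∈ NSet p a, Φ (t i) u = subSeq p u 1 i) ∧
        (∀ g : G, ∃ w : List ℕ, (∀ d ∈ w, d < p) ∧
          ∀ u ∈ NSet p a, Φ g u = w.foldl (fun v d => subSeq p v 1 d) u) ∧
        (∀ w : List ℕ, (∀ d ∈ w, d < p) →
          ∃ g : G, ∀ u ∈ NSet p a, Φ g u = w.foldl (fun v d => subSeq p v 1 d) u) := by
  subst haeq
  set β : Q → (ℕ → Δ) := fun q => schreierSeq p act t q τ with hβ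
  have hfold : ∀ (w : List ℕ) (q : Q),
      w.foldl (fun q d => act q (t d)) q = act q (w.map t).prod := by
    intro w
    induction w with
    | nil => intro q; simp [hact_one]
    | cons d w ih => intro q; simp [ih, hact_mul]
  have hstep : ∀ q : Q, ∀ i < p, β (act q (t i)) = subSeq p (β q) 1 i := by
    intro q i hi
    funext k
    have h1 : 0 < p * (k + 1) := by positivity
    have h2 : p ^ 1 * (k + 1) + i - 1 + 1 = i + p * (k + 1) := by rw [pow_one]; omega
    simp only [hβ, schreierSeq, subSeq]
    rw [h2, Nat.digits_add p (by omega) i (k + 1) hi (Or.inr (by omega)), List.foldl_cons]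
  have hword : ∀ w : List ℕ, (∀ d ∈ w, d < p) → ∀ q : Q,
      w.foldl (fun v d => subSeq p v 1 d) (β q) = β (act q (w.map t).prod) := by
    intro w
    induction w with
    | nil => intro _ q; simp [hact_one]
    | cons d w ih =>
      intro hw q
      rw [List.foldl_cons, ← hstep q d (hw d (by simp)), ih (fun e he => hw e (by simp [he]))]
      simp [hact_mul]
  have hrange : Set.range β = NSet p (β q₀) := by
    ext u
    constructor
    · rintro ⟨q, rfl⟩
      obtain ⟨g, rfl⟩ := htrans q₀ q
      obtain ⟨w, hw, rfl⟩ := exists_word t hgen g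
      refine ⟨w.length, Nat.ofDigits p w, Nat.ofDigits_lt_base_pow_length (by omega) hw, ?_⟩
      rw [← hword w hw, sub_foldl hp]
    · rintro ⟨i, j, hj, rfl⟩
      obtain ⟨w, h1, h2, h3⟩ := word_of hp i j hj
      refine ⟨act q₀ (w.map t).prod, ?_⟩
      rw [← hword w h2, sub_foldl hp, h1, h3]
  have hinj : Function.Injective β := by
    intro q q' h
    have hall : ∀ g : G, τ (act q g) = τ (act q' g) := by
      intro g
      obtain ⟨w, hw, hg⟩ := exists_word_last t hgen g 1
      have hd : Nat.digits p (Nat.ofDigits p (w ++ [1])) = w ++ [1] := by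
        apply Nat.digits_ofDigits p (by omega)
        · intro d hd
          rcases List.mem_append.1 hd with hd | hd
          · exact hw d hd
          · simp at hd; omega
        · simp
      have hne : Nat.ofDigits p (w ++ [1]) ≠ 0 := by
        intro h0
        rw [h0] at hd
        simp at hd
      have := congrFun h (Nat.ofDigits p (w ++ [1]) - 1)
      simp only [hβ, schreierSeq] at this
      rwa [Nat.sub_add_cancel (by omega), hd, hfold, hfold, hg] at this
    obtain ⟨g₁, rfl⟩ := htrans q₀ q
    obtain ⟨g₂, rfl⟩ := htrans q₀ q'
    have := hdagger (g₁ * g₂⁻¹) (by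
      intro g
      rw [mul_assoc, hact_mul, hall, ← hact_mul, mul_inv_cancel_left])
    calc act q₀ g₁ = act (act q₀ (g₁ * g₂⁻¹)) g₂ := by rw [← hact_mul]; simp
      _ = act q₀ g₂ := by rw [this]
  have hN : ∀ u ∈ NSet p (β q₀), ∃ q, β q = u := by
    intro u hu
    rw [← hrange] at hu
    exact hu
  have hN' : ∀ q, β q ∈ NSet p (β q₀) := by
    intro q
    rw [← hrange]
    exact ⟨q, rfl⟩
  change (∀ r < p, ∃ i j : ℕ, j < p ^ i ∧ (i, j) ≠ (0, 0) ∧ j / p ^ (i - 1) = r ∧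
        ∀ u ∈ NSet p (β q₀), subSeq p u i j = u) ∧
    (∀ i < p, Set.BijOn (fun u => subSeq p u 1 i) (NSet p (β q₀)) (NSet p (β q₀))) ∧ _
  refine ⟨?_, ?_, β, rfl, hrange, hinj, hstep, ?_⟩
  · intro r hr
    obtain ⟨w, hw, hg⟩ := exists_word_last t hgen 1 r
    have hw' : ∀ d ∈ w ++ [r], d < p := by
      intro d hd
      rcases List.mem_append.1 hd with hd | hd
      · exact hw d hd
      · simp at hd; omega
    refine ⟨(w ++ [r]).length, Nat.ofDigits p (w ++ [r]),
      Nat.ofDigits_lt_base_pow_length (by omega) hw', by simp, ?_, ?_⟩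
    · rw [Nat.ofDigits_append, Nat.ofDigits_singleton]
      simp only [List.length_append, List.length_singleton, Nat.add_sub_cancel]
      rw [Nat.add_mul_div_left _ _ (by positivity),
        Nat.div_eq_of_lt (Nat.ofDigits_lt_base_pow_length (by omega) hw), zero_add]
    · intro u hu
      obtain ⟨q, rfl⟩ := hN u hu
      rw [← sub_foldl hp, hword _ hw', hg, hact_one]
  · intro i hi
    refine ⟨?_, ?_, ?_⟩
    · intro u hu
      obtain ⟨q, rfl⟩ := hN u hu
      change subSeq p (β q) 1 i ∈ _
      rw [← hstep q i hi]
      exact hN' _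
    · intro u hu v hv huv
      obtain ⟨q, rfl⟩ := hN u hu
      obtain ⟨q', rfl⟩ := hN v hv
      change subSeq p (β q) 1 i = subSeq p (β q') 1 i at huv
      rw [← hstep q i hi, ← hstep q' i hi] at huv
      have h := congrArg (fun x => act x (t i)⁻¹) (hinj huv)
      simp only [← hact_mul, mul_inv_cancel, hact_one] at h
      rw [h]
    · intro u hu
      obtain ⟨q, rfl⟩ := hN u hu
      refine ⟨β (act q (t i)⁻¹), hN' _, ?_⟩
      change subSeq p (β _) 1 i = _
      rw [← hstep _ i hi, ← hact_mul, inv_mul_cancel, hact_one]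
  · have : Nonempty Q := ⟨q₀⟩
    have hΦ : ∀ (g : G) (q : Q), β (act (Function.invFun β (β q)) g) = β (act q g) := by
      intro g q
      rw [Function.leftInverse_invFun hinj q]
    refine ⟨fun g u => β (act (Function.invFun β u) g), hΦ, ?_, ?_, ?_, ?_, ?_⟩
    · intro g₁ g₂ h
      have h1 : ∀ q, act q g₁ = act q g₂ := by
        intro q
        have := h (β q) (hN' q)
        simp only [hΦ] at this
        exact hinj this
      have := hfaithful (g₁ * g₂⁻¹) (by
        intro q
        rw [hact_mul, h1, ← hact_mul, mul_inv_cancel, hact_one])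
      exact mul_inv_eq_one.1 this
    · intro g h u hu
      obtain ⟨q, rfl⟩ := hN u hu
      simp only [hΦ]
      rw [hact_mul]
    · intro i hi u hu
      obtain ⟨q, rfl⟩ := hN u hu
      simp only [hΦ]
      exact hstep q i hi
    · intro g
      obtain ⟨w, hw, rfl⟩ := exists_word t hgen g
      refine ⟨w, hw, ?_⟩
      intro u hu
      obtain ⟨q, rfl⟩ := hN u hu
      simp only [hΦ]
      exact (hword w hw q).symm
    · intro w hw
      refine ⟨(w.map t).prod, ?_⟩
      intro u hu
      obtain ⟨q, rfl⟩ := hN u hu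
      simp only [hΦ]
      exact (hword w hw q).symm
end

section
/- Let p ≥ 2 and let a be a p-automatic sequence. If a is self-similar, then a is homogeneous; that is, if a is equivalent to every u ∈ N(a), then N(u) = N(a) and rel(u) = rel(a) for every u ∈ N(a). -/
open scoped Classical

/-- `a` is self-similar if `a` is equivalent to every `u ∈ N(a)`: each `u ∈ N(a)` is obtained
from `a` by a bijection of the alphabet. -/
def SelfSimilar (p : ℕ) {Δ : Type*} (a : ℕ → Δ) : Prop :=
  ∀ u ∈ NSet p a, ∃ φ : Δ ≃ Δ, ∀ k, u k = φ (a k)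

theorem subSeq_subSeq_aux {p : ℕ} (hp : 2 ≤ p) {Δ : Type*} (a : ℕ → Δ) (i j k l : ℕ) :
    subSeq p (subSeq p a i j) k l = subSeq p a (i + k) (p ^ i * l + j) := by
  funext n
  have h1 : 0 < p ^ k * (n + 1) := Nat.mul_pos (Nat.pow_pos (by omega)) (Nat.succ_pos n)
  have h2 : p ^ k * (n + 1) + l - 1 + 1 = p ^ k * (n + 1) + l := by omega
  simp only [subSeq]
  rw [h2]
  congr 2
  ring

theorem NSet_subset_aux {p : ℕ} (hp : 2 ≤ p) {Δ : Type*} (a u : ℕ → Δ) (hu : u ∈ NSet p a) :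
    NSet p u ⊆ NSet p a := by
  obtain ⟨i, j, hj, rfl⟩ := hu
  rintro v ⟨k, l, hl, rfl⟩
  refine ⟨i + k, p ^ i * l + j, ?_, subSeq_subSeq_aux hp a i j k l⟩
  calc p ^ i * l + j < p ^ i * l + p ^ i := by omega
    _ = p ^ i * (l + 1) := by ring
    _ ≤ p ^ i * p ^ k := Nat.mul_le_mul_left _ hl
    _ = p ^ (i + k) := (pow_add _ _ _).symm

/-- Self-similar sequences are homogeneous. -/
theorem stmt_13 {p : ℕ} (hp : 2 ≤ p) {Δ : Type*} [Finite Δ] (a : ℕ → Δ)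
    (ha : IsAutomatic p a) (hss : SelfSimilar p a) :
    Homogeneous p a := by
  intro u hu
  have hsub := NSet_subset_aux hp a u hu
  obtain ⟨φ, hφ⟩ := hss u hu
  have hu' : u = φ ∘ a := funext hφ
  have hinj : Function.Injective (fun v : ℕ → Δ => φ ∘ v) := φ.injective.comp_left
  have himg : NSet p u = (fun v : ℕ → Δ => φ ∘ v) '' NSet p a := by
    ext v
    constructor
    · rintro ⟨i, j, hj, rfl⟩
      exact ⟨subSeq p a i j, ⟨i, j, hj, rfl⟩, by rw [hu']; rfl⟩
    · rintro ⟨w, ⟨i, j, hj, rfl⟩, rfl⟩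
      exact ⟨i, j, hj, by rw [hu']; rfl⟩
  refine ⟨Set.eq_of_subset_of_ncard_le hsub ?_ ha, ?_⟩
  · rw [himg, Set.ncard_image_of_injective _ hinj]
  · ext ⟨i, j⟩
    have h : subSeq p u i j = u ↔ subSeq p a i j = a := by
      rw [hu']
      exact hinj.eq_iff (a := subSeq p a i j) (b := a)
    simp only [relSet, Set.mem_setOf_eq, h]
end

section
/- Let p ≥ 2 and let a be a p-automatic sequence with values in a commutative ring R. Let M be the square matrix indexed by N(a) with entries in ℤ[x_0, …, x_{p−1}] given by M_{u,v} = Σ_{i : t_i(u) = v} x_i, and let D = det(I − M) ∈ ℤ[x_0, …, x_{p−1}]. Then D is a nonzero polynomial with constant term 1, and there exists a polynomial N ∈ R[x_0, …, x_{p−1}] such that D · L(a, x_0, …, x_{p−1}) = N in R[[x_0, …, x_{p−1}]] (the coefficients of D being interpreted in R via the canonical map ℤ → R). In particular, L(a, x_0, …, x_{p−1}) is a rational fraction. -/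
open scoped Classical

/-- `L(u, x_0, …, x_{p-1}) = ∑_{n ≥ 1} u_n x_0^{ℓ_0(n)} ⋯ x_{p-1}^{ℓ_{p-1}(n)}`, where
`ℓ_i(n)` is the number of occurrences of the digit `i` in the base-`p` expansion of `n`.
The coefficient of the monomial with exponents `m` is the (finite) sum of the terms `u_n` over
those `n` whose digit counts are given by `m`. -/
noncomputable def Lseries (p : ℕ) {R : Type*} [CommRing R] (u : ℕ → R) :
    MvPowerSeries (Fin p) R :=
  (fun m => ∑ n ∈ (Finset.range (p ^ (Finset.univ.sum fun i => m i))).filter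
      (fun n => ∀ i : Fin p, (Nat.digits p (n + 1)).count (i : ℕ) = m i), u n :
    (Fin p →₀ ℕ) → R)

/-- `det (I - M)` where `M` is the weighted adjacency matrix of `Γ(a)`:
`M_{u,v} = ∑_{i : t_i(u) = v} x_i`. -/
noncomputable def weightedDet (p : ℕ) {Δ : Type*} (a : ℕ → Δ) (ha : IsAutomatic p a) :
    MvPolynomial (Fin p) ℤ :=
  letI : Fintype ↥(NSet p a) := Set.Finite.fintype ha
  letI : DecidableEq ↥(NSet p a) := Classical.decEq _
  Matrix.det (1 - Matrix.of (fun u v : ↥(NSet p a) =>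
    ∑ i ∈ Finset.univ.filter
        (fun i : Fin p => subSeq p (u : ℕ → Δ) 1 (i : ℕ) = (v : ℕ → Δ)),
      MvPolynomial.X i))

/-- digit counts as a finsupp -/
noncomputable def digCount (p n : ℕ) : Fin p →₀ ℕ :=
  Finsupp.equivFunOnFinite.symm (fun i => (Nat.digits p n).count (i : ℕ))

/-- truncation term -/
noncomputable def trTerm (p : ℕ) {R : Type*} [CommRing R] (u : ℕ → R) (m : Fin p →₀ ℕ)
    (n : ℕ) : R := if digCount p n = m then u (n - 1) else 0

theorem digCount_mul_add {p : ℕ} (hp : 2 ≤ p) (k : ℕ) (hk : 1 ≤ k) (i : Fin p) :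
    digCount p (p * k + i) = digCount p k + Finsupp.single i 1 := by
  ext j
  have h := Nat.digits_add_two_add_one (p - 2) (p * k + i - 1)
  have h2 : Nat.digits p (p * k + i) = (i : ℕ) :: Nat.digits p k := by
    rw [add_comm]
    exact Nat.digits_add p (by omega) i k i.2 (Or.inr (by omega))
  simp only [digCount, Finsupp.add_apply, Finsupp.equivFunOnFinite_symm_apply_apply, h2,
    List.count_cons, Finsupp.single_apply, Fin.ext_iff, beq_iff_eq]

theorem digCount_small {p : ℕ} (n : ℕ) (hn : 1 ≤ n) (h : n < p) :
    digCount p n = Finsupp.single (⟨n, h⟩ : Fin p) 1 := by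
  ext j
  simp only [digCount, Finsupp.equivFunOnFinite_symm_apply_apply,
    Nat.digits_of_lt p n (by omega) h, List.count_cons, List.count_nil, zero_add,
    Finsupp.single_apply, Fin.ext_iff, beq_iff_eq]

theorem lt_of_digCount {p : ℕ} (hp : 2 ≤ p) (n : ℕ) (m : Fin p →₀ ℕ) (h : digCount p n = m) :
    n < p ^ (Finset.univ.sum fun i => m i) := by
  subst h
  have hl : (Finset.univ.sum fun i => digCount p n i) = (Nat.digits p n).length := by
    simp only [digCount, Finsupp.equivFunOnFinite_symm_apply_apply]
    rw [Fin.sum_univ_eq_sum_range (fun i => (Nat.digits p n).count i) p]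
    have := Multiset.sum_count_eq_card (s := Finset.range p) (m := (Nat.digits p n : Multiset ℕ))
      (by
        intro a ha
        exact Finset.mem_range.2 (Nat.digits_lt_base (by omega) (by simpa using ha)))
    simpa using this
  rw [hl]
  exact Nat.lt_base_pow_length_digits (by omega)

theorem coeff_Lseries {p : ℕ} (hp : 2 ≤ p) {R : Type*} [CommRing R] (u : ℕ → R)
    (m : Fin p →₀ ℕ) (B : ℕ) (hB : p ^ (Finset.univ.sum fun i => m i) ≤ B) :
    MvPowerSeries.coeff m (Lseries p u) = ∑ n ∈ Finset.Ico 1 B, trTerm p u m n := by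
  have h0 : MvPowerSeries.coeff m (Lseries p u) =
    ∑ n ∈ (Finset.range (p ^ (Finset.univ.sum fun i => m i))).filter
      (fun n => ∀ i : Fin p, (Nat.digits p (n + 1)).count (i : ℕ) = m i), u n := rfl
  have hiff : ∀ n, (∀ i : Fin p, (Nat.digits p (n + 1)).count (i : ℕ) = m i) ↔
      digCount p (n + 1) = m := by
    intro n
    rw [Finsupp.ext_iff]
    rfl
  rw [h0]
  unfold trTerm
  rw [← Finset.sum_filter]
  refine Finset.sum_bij' (fun n _ => n + 1) (fun n _ => n - 1) ?_ ?_ ?_ ?_ ?_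
  · intro n hn
    rw [Finset.mem_filter, hiff] at hn
    have := lt_of_digCount hp _ _ hn.2
    rw [Finset.mem_filter, Finset.mem_Ico]
    exact ⟨⟨by omega, by omega⟩, hn.2⟩
  · intro n hn
    rw [Finset.mem_filter, Finset.mem_Ico] at hn
    have := lt_of_digCount hp _ _ hn.2
    rw [Finset.mem_filter, hiff, Finset.mem_range, Nat.sub_add_cancel hn.1.1]
    exact ⟨by omega, hn.2⟩
  · intro n hn
    simp
  · intro n hn
    rw [Finset.mem_filter, Finset.mem_Ico] at hn
    exact Nat.sub_add_cancel hn.1.1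
  · intro n hn
    simp

/-- initial polynomial -/
noncomputable def initPoly (p : ℕ) {R : Type*} [CommRing R] (u : ℕ → R) : MvPolynomial (Fin p) R :=
  ∑ n ∈ Finset.Ico 1 p, MvPolynomial.monomial (digCount p n) (u (n - 1))

theorem sum_split {R : Type*} [CommRing R] (f : ℕ → R) (p : ℕ) (hp : 2 ≤ p) (K : ℕ) :
    ∑ n ∈ Finset.Ico 1 (p * (K + 1)), f n = ∑ n ∈ Finset.Ico 1 p, f n +
      ∑ i : Fin p, ∑ k ∈ Finset.Ico 1 (K + 1), f (p * k + i) := by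
  induction K with
  | zero => simp
  | succ K ih =>
    rw [← Finset.sum_Ico_consecutive f (m := 1) (n := p * (K + 1)) (by nlinarith) (by nlinarith),
      ih, add_assoc]
    congr 1
    simp_rw [fun i : Fin p => Finset.sum_Ico_succ_top (show 1 ≤ K + 1 by omega) 
      (fun k => f (p * k + i))]
    rw [Finset.sum_add_distrib, Fin.sum_univ_eq_sum_range (fun i => f (p * (K + 1) + i)) p,
      Finset.sum_Ico_eq_sum_range]
    congr 2
    congr 1
    rw [mul_add p (K+1) 1]
    omega

theorem Lseries_rec {p : ℕ} (hp : 2 ≤ p) {R : Type*} [CommRing R] (u : ℕ → R) :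
    Lseries p u = (initPoly p u : MvPowerSeries (Fin p) R) +
      ∑ i : Fin p, MvPowerSeries.X i * Lseries p (subSeq p u 1 i) := by
  ext m
  set K := p ^ (Finset.univ.sum fun i => m i) with hK
  rw [coeff_Lseries hp u m (p * (K + 1)) (by rw [← hK]; nlinarith), sum_split _ _ hp, map_add,
    map_sum]
  congr 1
  · rw [MvPolynomial.coeff_coe, initPoly, MvPolynomial.coeff_sum]
    refine Finset.sum_congr rfl fun n _ => ?_
    rw [MvPolynomial.coeff_monomial, trTerm]
  · refine Finset.sum_congr rfl fun i _ => ?_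
    rw [MvPowerSeries.X, MvPowerSeries.coeff_monomial_mul]
    split_ifs with h
    · rw [one_mul, coeff_Lseries hp _ _ (K + 1)]
      · refine Finset.sum_congr rfl fun k hk => ?_
        have hk1 := (Finset.mem_Ico.1 hk).1
        unfold trTerm subSeq
        rw [digCount_mul_add hp k hk1, Nat.sub_add_cancel hk1, pow_one]
        have : digCount p k + Finsupp.single i 1 = m ↔ digCount p k = m - Finsupp.single i 1 :=
          (eq_tsub_iff_add_eq_of_le h).symm
        simp only [this]
      · refine le_trans (Nat.pow_le_pow_right (by omega) (Finset.sum_le_sum fun j _ => ?_))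
          (Nat.le_succ _)
        rw [Finsupp.tsub_apply]
        omega
    · refine Finset.sum_eq_zero fun k hk => ?_
      have hk1 := (Finset.mem_Ico.1 hk).1
      unfold trTerm
      rw [digCount_mul_add hp k hk1, if_neg]
      rintro rfl
      exact h le_add_self

theorem subSeq_mem {p : ℕ} (hp : 2 ≤ p) {R : Type*} (a u : ℕ → R) (hu : u ∈ NSet p a)
    (i : Fin p) : subSeq p u 1 i ∈ NSet p a := by
  obtain ⟨e, j, hj, rfl⟩ := hu
  refine ⟨e + 1, p ^ e * i + j, ?_, ?_⟩
  · have := i.2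
    calc p ^ e * i + j < p ^ e * i + p ^ e := by omega
      _ = p ^ e * (i + 1) := by ring
      _ ≤ p ^ e * p := Nat.mul_le_mul_left _ this
      _ = _ := by ring
  · funext k
    unfold subSeq
    have : 1 ≤ p ^ 1 * (k + 1) + i := by nlinarith
    rw [Nat.sub_add_cancel this]
    congr 2
    ring

/-- the weighted adjacency matrix -/
noncomputable def adjM (p : ℕ) {R : Type*} (a : ℕ → R) :
    Matrix (NSet p a) (NSet p a) (MvPolynomial (Fin p) ℤ) :=
  Matrix.of (fun u v : ↥(NSet p a) =>
    ∑ i ∈ Finset.univ.filter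
        (fun i : Fin p => subSeq p (u : ℕ → R) 1 (i : ℕ) = (v : ℕ → R)),
      MvPolynomial.X i)

/-- `D = det(I - M)` is a nonzero polynomial with constant term `1`, and `D · L(a)` is a
(multivariate) polynomial; in particular `L(a, x_0, …, x_{p-1})` is a rational fraction. -/
theorem stmt_15 {p : ℕ} (hp : 2 ≤ p) {R : Type*} [CommRing R] (a : ℕ → R)
    (ha : IsAutomatic p a) :
    weightedDet p a ha ≠ 0 ∧
    MvPolynomial.coeff 0 (weightedDet p a ha) = 1 ∧
    ∃ N : MvPolynomial (Fin p) R,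
      ((MvPolynomial.map (Int.castRingHom R) (weightedDet p a ha) :
          MvPolynomial (Fin p) R) : MvPowerSeries (Fin p) R) * Lseries p a
        = (N : MvPowerSeries (Fin p) R) := by
  letI : Fintype ↥(NSet p a) := Set.Finite.fintype ha
  letI : DecidableEq ↥(NSet p a) := Classical.decEq _
  have hD : weightedDet p a ha = Matrix.det (1 - adjM p a) := by
    unfold weightedDet adjM
    rfl
  have hc : MvPolynomial.coeff 0 (weightedDet p a ha) = 1 := by
    rw [hD, ← MvPolynomial.constantCoeff_eq, RingHom.map_det]
    have : (MvPolynomial.constantCoeff (R := ℤ) (σ := Fin p)).mapMatrix (1 - adjM p a) = 1 := by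
      rw [map_sub, map_one, sub_eq_self]
      ext u v
      simp [adjM]
    rw [this, Matrix.det_one]
  refine ⟨?_, hc, ?_⟩
  · intro h
    rw [h] at hc
    simp at hc
  · let φ : MvPolynomial (Fin p) ℤ →+* MvPolynomial (Fin p) R :=
      MvPolynomial.map (Int.castRingHom R)
    let ψ : MvPolynomial (Fin p) R →+* MvPowerSeries (Fin p) R :=
      MvPolynomial.coeToMvPowerSeries.ringHom
    let A : Matrix (NSet p a) (NSet p a) (MvPolynomial (Fin p) R) := φ.mapMatrix (1 - adjM p a)
    let P : NSet p a → MvPolynomial (Fin p) R := fun u => initPoly p (u : ℕ → R)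
    let L : NSet p a → MvPowerSeries (Fin p) R := fun u => Lseries p (u : ℕ → R)
    have hAL : (ψ.mapMatrix A).mulVec L = ψ ∘ P := by
      have h1 : ψ.mapMatrix A = 1 - (adjM p a).map (ψ.comp φ) := by
        simp only [A, map_sub, map_one]
        rfl
      rw [h1, Matrix.sub_mulVec, Matrix.one_mulVec, sub_eq_iff_eq_add]
      funext u
      have h2 : ((adjM p a).map (ψ.comp φ)).mulVec L u =
          ∑ i : Fin p, MvPowerSeries.X i * Lseries p (subSeq p (u : ℕ → R) 1 i) := by
        simp only [Matrix.mulVec, dotProduct, Matrix.map_apply, adjM, Matrix.of_apply, map_sum,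
          Finset.sum_filter, Finset.sum_mul]
        rw [Finset.sum_comm]
        refine Finset.sum_congr rfl fun i _ => ?_
        rw [Finset.sum_eq_single (⟨_, subSeq_mem hp a u u.2 i⟩ : NSet p a)]
        · simp [L, φ, ψ]
        · intro v _ hv
          rw [if_neg]
          · simp
          · intro h
            exact hv (Subtype.ext h.symm)
        · intro h
          exact absurd (Finset.mem_univ _) h
      rw [Pi.add_apply, h2]
      exact Lseries_rec hp (u : ℕ → R)
    have ha0 : a ∈ NSet p a := ⟨0, 0, by simp, by funext k; simp [subSeq]⟩
    refine ⟨(A.adjugate.mulVec P) ⟨a, ha0⟩, ?_⟩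
    have h3 : (ψ.mapMatrix A).adjugate.mulVec ((ψ.mapMatrix A).mulVec L) =
        (ψ.mapMatrix A).det • L := by
      rw [Matrix.mulVec_mulVec, Matrix.adjugate_mul, Matrix.smul_mulVec, Matrix.one_mulVec]
    have h4 := congrFun h3 ⟨a, ha0⟩
    rw [hAL, ← RingHom.map_adjugate, ← RingHom.map_det] at h4
    have h5 : (ψ.mapMatrix A.adjugate).mulVec (ψ ∘ P) ⟨a, ha0⟩ =
        ψ (A.adjugate.mulVec P ⟨a, ha0⟩) := (RingHom.map_mulVec ψ _ _ _).symm
    rw [h5] at h4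
    have h6 : A.det = φ (weightedDet p a ha) := by
      rw [hD, RingHom.map_det]
    rw [h6] at h4
    exact h4.symm
end
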